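/- arXiv:1703.09848 — 5 statements merged into one kernel-verified Lean document; each statement's English description precedes it below -/
import Mathlib

section
/- Suppose the linear operators 𝒜₁,…,𝒜ₛ : ℝ^{n×n} → ℝ^m satisfy the ARIP at rank 2r with parameter δ₂ᵣ and at rank 3r with parameter δ₃ᵣ (δ₂ᵣ ≤ δ₃ᵣ < 1). Let X₁,…,Xₛ ∈ ℝ^{n×n} have rank exactly r, set σ_min = min_k σ_min(X_k), and let y = Σ_{k=1}^s 𝒜_k(X_k). Let X_{k,l} be rank-r matrices, and define r_l = y − Σ_k 𝒜_k(X_{k,l}), G_{k,l} = 𝒜_k^*(r_l), α_{k,l} = ‖P_{T_{k,l}}(G_{k,l})‖_F² / ‖𝒜_k(P_{T_{k,l}}(G_{k,l}))‖² (with P_{T_{k,l}}(G_{k,l}) ≠ 0), and let X_{k,l+1} be a best rank-r approximation of X_{k,l} + α_{k,l} P_{T_{k,l}}(G_{k,l}). Writing E_l = √(Σ_{k=1}^s ‖X_{k,l} − X_k‖_F²), one has E_{l+1} ≤ 2·(2δ₂ᵣ/(1−δ₂ᵣ) + δ₃ᵣ/(1−δ₂ᵣ) + E_l/σ_min)·E_l.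 -/
open Matrix MeasureTheory ProbabilityTheory Finset

noncomputable section

/-- Frobenius inner product on square real matrices: `⟨X,Y⟩ = trace (Xᵀ Y)`. -/
def finner {n : ℕ} (X Y : Matrix (Fin n) (Fin n) ℝ) : ℝ := (Xᵀ * Y).trace

/-- Frobenius norm. -/
def fnorm {n : ℕ} (X : Matrix (Fin n) (Fin n) ℝ) : ℝ := Real.sqrt (finner X X)

/-- Euclidean norm on `ℝ^m`. -/
def enorm2 {m : ℕ} (v : Fin m → ℝ) : ℝ := Real.sqrt (∑ p, (v p) ^ 2)

/-- The linear operator `𝒜` associated with measurement matrices `A_p`: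
`(𝒜 Z)_p = (1/√m) ⟨A_p, Z⟩`. -/
def opA {n m : ℕ} (A : Fin m → Matrix (Fin n) (Fin n) ℝ)
    (Z : Matrix (Fin n) (Fin n) ℝ) : Fin m → ℝ :=
  fun p => (1 / Real.sqrt m) * finner (A p) Z

/-- The adjoint operator `𝒜^* v = (1/√m) Σ_p v_p A_p`. -/
def adjA {n m : ℕ} (A : Fin m → Matrix (Fin n) (Fin n) ℝ)
    (v : Fin m → ℝ) : Matrix (Fin n) (Fin n) ℝ :=
  (1 / Real.sqrt m) • ∑ p, v p • A p

/-- Amalgam restricted isometry property at rank `r` with parameter `δ`. -/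
def ARIP {n m s : ℕ} (𝒜 : Fin s → Matrix (Fin n) (Fin n) ℝ → (Fin m → ℝ))
    (r : ℕ) (δ : ℝ) : Prop :=
  ∀ Z : Fin s → Matrix (Fin n) (Fin n) ℝ, (∀ k, (Z k).rank ≤ r) →
    (1 - δ) * ∑ k, fnorm (Z k) ^ 2 ≤ enorm2 (∑ k, 𝒜 k (Z k)) ^ 2 ∧
    enorm2 (∑ k, 𝒜 k (Z k)) ^ 2 ≤ (1 + δ) * ∑ k, fnorm (Z k) ^ 2

/-- Orthogonal projection onto the tangent space determined by the SVD factors `U`, `V`: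
`P_T(G) = UUᵀG + GVVᵀ − UUᵀGVVᵀ`. -/
def Pt {n r : ℕ} (U V : Matrix (Fin n) (Fin r) ℝ)
    (G : Matrix (Fin n) (Fin n) ℝ) : Matrix (Fin n) (Fin n) ℝ :=
  U * Uᵀ * G + G * (V * Vᵀ) - U * Uᵀ * G * (V * Vᵀ)

/-- `X'` is a best rank-`r` approximation of `W` in Frobenius norm. -/
def IsBestRankApprox {n : ℕ} (r : ℕ) (W X' : Matrix (Fin n) (Fin n) ℝ) : Prop :=
  X'.rank ≤ r ∧ ∀ Z : Matrix (Fin n) (Fin n) ℝ, Z.rank ≤ r → fnorm (X' - W) ≤ fnorm (Z - W)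

open scoped InnerProductSpace

/-- Sum of squared entries. -/
def NN {a b : ℕ} (M : Matrix (Fin a) (Fin b) ℝ) : ℝ := ∑ i, ∑ j, M i j ^ 2

lemma NN_nonneg {a b : ℕ} (M : Matrix (Fin a) (Fin b) ℝ) : 0 ≤ NN M :=
  Finset.sum_nonneg fun _ _ => Finset.sum_nonneg fun _ _ => sq_nonneg _

lemma NN_eq {a b : ℕ} (M : Matrix (Fin a) (Fin b) ℝ) : NN M = (M * Mᵀ).trace := by
  simp [NN, Matrix.trace, Matrix.mul_apply, sq]

lemma NN_transpose {a b : ℕ} (M : Matrix (Fin a) (Fin b) ℝ) : NN Mᵀ = NN M := by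
  simp only [NN, Matrix.transpose_apply]
  exact Finset.sum_comm

lemma NN_eq' {a b : ℕ} (M : Matrix (Fin a) (Fin b) ℝ) : NN M = (Mᵀ * M).trace := by
  rw [← NN_transpose, NN_eq, Matrix.transpose_transpose]

lemma NN_split {a b c : ℕ} (U : Matrix (Fin a) (Fin c) ℝ) (hU : Uᵀ * U = 1)
    (D : Matrix (Fin a) (Fin b) ℝ) : NN D = NN (Uᵀ * D) + NN ((1 - U * Uᵀ) * D) := by
  have h1 : (1 - U * Uᵀ)ᵀ * (1 - U * Uᵀ) = 1 - U * Uᵀ := by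
    have : U * Uᵀ * (U * Uᵀ) = U * Uᵀ := by
      rw [Matrix.mul_assoc, ← Matrix.mul_assoc Uᵀ, hU, Matrix.one_mul]
    simp only [Matrix.transpose_sub, Matrix.transpose_one, Matrix.transpose_mul,
      Matrix.transpose_transpose, Matrix.sub_mul, Matrix.mul_sub, Matrix.one_mul, Matrix.mul_one,
      this]
    abel
  have h2 : ((1 - U * Uᵀ) * D)ᵀ * ((1 - U * Uᵀ) * D) = Dᵀ * ((1 - U * Uᵀ) * D) := by
    rw [Matrix.transpose_mul, Matrix.mul_assoc Dᵀ, ← Matrix.mul_assoc _ _ D, h1]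
  rw [NN_eq', NN_eq', NN_eq', h2, Matrix.transpose_mul, Matrix.transpose_transpose,
    ← Matrix.trace_add]
  congr 1
  simp only [Matrix.sub_mul, Matrix.mul_sub, Matrix.one_mul, Matrix.mul_assoc]
  abel

lemma NN_left_le {a b c : ℕ} (U : Matrix (Fin a) (Fin c) ℝ) (hU : Uᵀ * U = 1)
    (D : Matrix (Fin a) (Fin b) ℝ) : NN ((1 - U * Uᵀ) * D) ≤ NN D := by
  linarith [NN_split U hU D, NN_nonneg (Uᵀ * D)]

lemma NN_right_le {a b c : ℕ} (V : Matrix (Fin a) (Fin c) ℝ) (hV : Vᵀ * V = 1)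
    (D : Matrix (Fin b) (Fin a) ℝ) : NN (D * (1 - V * Vᵀ)) ≤ NN D := by
  rw [← NN_transpose, ← NN_transpose D]
  have := NN_left_le V hV Dᵀ
  simpa [Matrix.transpose_mul] using this

lemma NN_right_le' {a b c : ℕ} (V : Matrix (Fin a) (Fin c) ℝ) (hV : Vᵀ * V = 1)
    (D : Matrix (Fin b) (Fin a) ℝ) : NN (D * V) ≤ NN D := by
  rw [← NN_transpose, ← NN_transpose D, Matrix.transpose_mul]
  linarith [NN_split V hV Dᵀ, NN_nonneg ((1 - V * Vᵀ) * Dᵀ)]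

lemma NN_left_iso {a b c : ℕ} (U : Matrix (Fin a) (Fin c) ℝ) (hU : Uᵀ * U = 1)
    (D : Matrix (Fin b) (Fin c) ℝ) : NN (D * Uᵀ) = NN D := by
  rw [NN_eq, NN_eq, Matrix.transpose_mul, Matrix.transpose_transpose, Matrix.mul_assoc,
    ← Matrix.mul_assoc Uᵀ, hU, Matrix.one_mul]

lemma NN_mul {a b c : ℕ} (M : Matrix (Fin a) (Fin b) ℝ) (L : Matrix (Fin b) (Fin c) ℝ) :
    NN (M * L) ≤ NN M * NN L := by
  have : NN L = ∑ j, ∑ i, L i j ^ 2 := Finset.sum_comm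
  rw [this]
  unfold NN
  rw [Finset.sum_mul_sum]
  refine Finset.sum_le_sum fun i _ => Finset.sum_le_sum fun j _ => ?_
  rw [Matrix.mul_apply]
  exact Finset.sum_mul_sq_le_sq_mul_sq _ _ _

lemma finner_eq {n : ℕ} (X Y : Matrix (Fin n) (Fin n) ℝ) :
    finner X Y = ∑ i, ∑ j, X i j * Y i j := by
  simp only [finner, Matrix.trace, Matrix.mul_apply, Matrix.diag_apply, Matrix.transpose_apply]
  exact Finset.sum_comm

lemma fnorm_sq {n : ℕ} (X : Matrix (Fin n) (Fin n) ℝ) : fnorm X ^ 2 = NN X := by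
  have : finner X X = NN X := by simp [finner_eq, NN, sq]
  rw [fnorm, this, Real.sq_sqrt (NN_nonneg X)]

/-- Tangent-space complement estimate. -/
lemma tangent_est {n r : ℕ} (X D : Matrix (Fin n) (Fin n) ℝ)
    (UX VX U V : Matrix (Fin n) (Fin r) ℝ) (SX S : Matrix (Fin r) (Fin r) ℝ)
    (hUX : UXᵀ * UX = 1) (hVX : VXᵀ * VX = 1)
    (hd : ∀ i j, i ≠ j → SX i j = 0) (σ : ℝ) (hσ : 0 < σ) (hp : ∀ i, σ ≤ SX i i)
    (hX : X = UX * SX * VXᵀ) (hU : Uᵀ * U = 1) (hV : Vᵀ * V = 1)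
    (hD : D = U * S * Vᵀ - X) :
    NN ((1 - U * Uᵀ) * D * (1 - V * Vᵀ)) ≤ (NN D / σ) ^ 2 := by
  set T : Matrix (Fin r) (Fin r) ℝ := Matrix.diagonal fun i => (SX i i)⁻¹ with hT
  have hS : SX = Matrix.diagonal fun i => SX i i := by
    ext i j
    by_cases h : i = j
    · subst h; simp
    · rw [Matrix.diagonal_apply_ne _ h, hd i j h]
  have hST : SX * T = 1 := by
    rw [hS, hT, Matrix.diagonal_mul_diagonal, ← Matrix.diagonal_one]
    congr 1; ext i
    exact mul_inv_cancel₀ (by linarith [hp i])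
  have hXYX : X * (VX * T * UXᵀ) * X = X := by
    calc X * (VX * T * UXᵀ) * X
        = UX * SX * (VXᵀ * VX) * T * (UXᵀ * UX) * SX * VXᵀ := by
          rw [hX]; simp only [Matrix.mul_assoc]
      _ = UX * (SX * T) * SX * VXᵀ := by
          rw [hUX, hVX]; simp only [Matrix.mul_assoc, Matrix.one_mul, Matrix.mul_one]
      _ = X := by rw [hST, hX]; simp only [Matrix.mul_one]
  have hL : (1 - U * Uᵀ) * (U * S * Vᵀ) = 0 := by
    have : (1 - U * Uᵀ) * U = 0 := by
      rw [Matrix.sub_mul, Matrix.mul_assoc, hU]; simp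
    rw [← Matrix.mul_assoc, ← Matrix.mul_assoc, this]; simp
  have hR : (U * S * Vᵀ) * (1 - V * Vᵀ) = 0 := by
    have : Vᵀ * (1 - V * Vᵀ) = 0 := by
      rw [Matrix.mul_sub, ← Matrix.mul_assoc, hV]; simp
    rw [Matrix.mul_assoc, this]; simp
  have h1 : (1 - U * Uᵀ) * D = -((1 - U * Uᵀ) * X) := by
    rw [hD, Matrix.mul_sub, hL]; simp
  have h2 : D * (1 - V * Vᵀ) = -(X * (1 - V * Vᵀ)) := by
    rw [hD, Matrix.sub_mul, hR]; simp
  have key : (1 - U * Uᵀ) * D * (1 - V * Vᵀ)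
      = (-(1 - U * Uᵀ)) * (D * (VX * T * UXᵀ) * D) * (1 - V * Vᵀ) := by
    calc (1 - U * Uᵀ) * D * (1 - V * Vᵀ)
        = -((1 - U * Uᵀ) * (X * (VX * T * UXᵀ) * X) * (1 - V * Vᵀ)) := by
          rw [h1, hXYX, Matrix.neg_mul]
      _ = -(((1 - U * Uᵀ) * X) * (VX * T * UXᵀ) * (X * (1 - V * Vᵀ))) := by
          simp only [Matrix.mul_assoc]
      _ = -(((1 - U * Uᵀ) * D) * (VX * T * UXᵀ) * (D * (1 - V * Vᵀ))) := by
          rw [h1, h2]; simp only [Matrix.neg_mul, Matrix.mul_neg, neg_neg]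
      _ = _ := by simp only [Matrix.mul_assoc, Matrix.neg_mul]
  have key2 : NN ((1 - U * Uᵀ) * D * (1 - V * Vᵀ)) ≤ NN (D * (VX * T * UXᵀ) * D) := by
    rw [key]
    refine (NN_right_le V hV _).trans ?_
    have : ∀ M : Matrix (Fin n) (Fin n) ℝ, NN (-M) = NN M := by intro M; simp [NN]
    rw [Matrix.neg_mul, this]
    exact NN_left_le U hU _
  have key3 : NN (D * (VX * T * UXᵀ)) ≤ NN D / σ ^ 2 := by
    have : D * (VX * T * UXᵀ) = (D * VX * T) * UXᵀ := by simp only [Matrix.mul_assoc]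
    rw [this, NN_left_iso UX hUX]
    refine le_trans ?_ (div_le_div_of_nonneg_right (NN_right_le' VX hVX D) (by positivity))
    unfold NN
    rw [Finset.sum_div]
    refine Finset.sum_le_sum fun i _ => ?_
    rw [Finset.sum_div]
    refine Finset.sum_le_sum fun j _ => ?_
    rw [hT, Matrix.mul_diagonal, mul_pow, div_eq_mul_inv, inv_pow]
    have := hp j
    gcongr
  calc _ ≤ _ := key2
    _ ≤ NN (D * (VX * T * UXᵀ)) * NN D := NN_mul _ _
    _ ≤ NN D / σ ^ 2 * NN D := by gcongr; exact NN_nonneg D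
    _ = _ := by ring

/-- Polarisation. -/
lemma polar {M H K : Type*} [AddCommGroup M] [Module ℝ M]
    [NormedAddCommGroup H] [InnerProductSpace ℝ H] [NormedAddCommGroup K] [InnerProductSpace ℝ K]
    (f : M →ₗ[ℝ] H) (g : M →ₗ[ℝ] K) (δ : ℝ) (z w : M)
    (h : ∀ a b : ℝ, (1 - δ) * ‖f (a • z + b • w)‖ ^ 2 ≤ ‖g (a • z + b • w)‖ ^ 2 ∧
      ‖g (a • z + b • w)‖ ^ 2 ≤ (1 + δ) * ‖f (a • z + b • w)‖ ^ 2) :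
    |⟪f z, f w⟫_ℝ - ⟪g z, g w⟫_ℝ| ≤ δ * ‖f z‖ * ‖f w‖ := by
  have hz := h 1 0
  have hw := h 0 1
  simp only [one_smul, zero_smul, add_zero, zero_add] at hz hw
  have zero_case : ∀ u : M, ‖g u‖ ^ 2 ≤ (1 + δ) * ‖f u‖ ^ 2 → f u = 0 → g u = 0 := by
    intro u hu hf
    rw [hf] at hu
    have : ‖g u‖ ^ 2 ≤ 0 := by simpa using hu
    have h0 : ‖g u‖ = 0 := by nlinarith [norm_nonneg (g u)]
    exact norm_eq_zero.mp h0
  by_cases hfz : f z = 0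
  · rw [hfz, zero_case z hz.2 hfz]; simp
  by_cases hfw : f w = 0
  · rw [hfw, zero_case w hw.2 hfw]; simp
  have hx : 0 < ‖f z‖ := norm_pos_iff.mpr hfz
  have hy : 0 < ‖f w‖ := norm_pos_iff.mpr hfw
  have hP := h ‖f w‖ ‖f z‖
  have hM := h ‖f w‖ (-‖f z‖)
  simp only [map_add, map_smul, neg_smul, map_neg] at hP hM
  simp only [← sub_eq_add_neg] at hM
  rw [norm_add_sq_real, norm_add_sq_real] at hP
  rw [norm_sub_sq_real, norm_sub_sq_real] at hM
  simp only [norm_smul, inner_smul_left, inner_smul_right, norm_norm, conj_trivial] at hP hM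
  set x := ‖f z‖
  set y := ‖f w‖
  set a := ⟪f z, f w⟫_ℝ
  set b := ⟪g z, g w⟫_ℝ
  have hxy : 0 < x * y := mul_pos hx hy
  rw [abs_le]
  constructor
  · have : (x * y) * (-(δ * x * y)) ≤ (x * y) * (a - b) := by nlinarith [hP.1, hP.2, hM.1, hM.2]
    exact le_of_mul_le_mul_left this hxy
  · have : (x * y) * (a - b) ≤ (x * y) * (δ * x * y) := by nlinarith [hP.1, hP.2, hM.1, hM.2]
    exact le_of_mul_le_mul_left this hxy

/-- Embedding of tuples of matrices into a Hilbert space. -/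
def Phi (s n : ℕ) : (Fin s → Matrix (Fin n) (Fin n) ℝ) →ₗ[ℝ]
    EuclideanSpace ℝ (Fin s × Fin n × Fin n) where
  toFun Z := WithLp.toLp 2 fun q => Z q.1 q.2.1 q.2.2
  map_add' _ _ := by ext; simp
  map_smul' _ _ := by ext; simp

lemma Phi_inner {s n : ℕ} (Z W : Fin s → Matrix (Fin n) (Fin n) ℝ) :
    ⟪Phi s n Z, Phi s n W⟫_ℝ = ∑ k, finner (Z k) (W k) := by
  simp [Phi, PiLp.inner_apply, finner_eq, Fintype.sum_prod_type, mul_comm]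

lemma Phi_norm_sq {s n : ℕ} (Z : Fin s → Matrix (Fin n) (Fin n) ℝ) :
    ‖Phi s n Z‖ ^ 2 = ∑ k, NN (Z k) := by
  rw [← real_inner_self_eq_norm_sq, Phi_inner]
  simp [finner_eq, NN, sq]

lemma Phi_norm_sq' {s n : ℕ} (Z : Fin s → Matrix (Fin n) (Fin n) ℝ) :
    ‖Phi s n Z‖ ^ 2 = ∑ k, fnorm (Z k) ^ 2 := by
  simp only [Phi_norm_sq, fnorm_sq]

lemma Phi_norm {s n : ℕ} (Z : Fin s → Matrix (Fin n) (Fin n) ℝ) :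
    Real.sqrt (∑ k, fnorm (Z k) ^ 2) = ‖Phi s n Z‖ := by
  rw [← Phi_norm_sq', Real.sqrt_sq (norm_nonneg _)]

lemma fnorm_eq_Phi {n : ℕ} (Z : Matrix (Fin n) (Fin n) ℝ) :
    fnorm Z = ‖Phi 1 n (fun _ => Z)‖ := by
  rw [← Phi_norm]; simp only [Finset.univ_unique, Finset.sum_singleton]
  exact (Real.sqrt_sq (Real.sqrt_nonneg _)).symm

lemma fnorm_tri {n : ℕ} (X Y Z : Matrix (Fin n) (Fin n) ℝ) :
    fnorm (X - Z) ≤ fnorm (X - Y) + fnorm (Z - Y) := by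
  simp only [fnorm_eq_Phi]
  have : (fun _ => X - Z : Fin 1 → Matrix (Fin n) (Fin n) ℝ)
      = (fun _ => X - Y) - (fun _ => Z - Y) := by ext; simp
  rw [this, map_sub]
  exact norm_sub_le _ _

/-- The amalgam operator. -/
def AA {s n m : ℕ} (A : Fin s → Fin m → Matrix (Fin n) (Fin n) ℝ) :
    (Fin s → Matrix (Fin n) (Fin n) ℝ) →ₗ[ℝ] EuclideanSpace ℝ (Fin m) where
  toFun Z := WithLp.toLp 2 (∑ k, opA (A k) (Z k))
  map_add' Z W := by
    ext p
    simp [opA, finner, Matrix.mul_add, mul_add, Finset.sum_add_distrib]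
  map_smul' c Z := by
    ext p
    simp only [opA, finner, Pi.smul_apply, Matrix.mul_smul, Matrix.trace_smul, smul_eq_mul,
      Finset.sum_apply, RingHom.id_apply, PiLp.smul_apply, Finset.mul_sum]
    exact Finset.sum_congr rfl fun _ _ => by ring

lemma AA_norm_sq {s n m : ℕ} (A : Fin s → Fin m → Matrix (Fin n) (Fin n) ℝ)
    (Z : Fin s → Matrix (Fin n) (Fin n) ℝ) :
    enorm2 (∑ k, opA (A k) (Z k)) ^ 2 = ‖AA A Z‖ ^ 2 := by
  rw [EuclideanSpace.norm_sq_eq, enorm2,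
    Real.sq_sqrt (Finset.sum_nonneg fun _ _ => sq_nonneg _)]
  simp [AA]

lemma arip_polar {s n m R : ℕ} (A : Fin s → Fin m → Matrix (Fin n) (Fin n) ℝ) (δ : ℝ)
    (h : ARIP (fun k => opA (A k)) R δ) (Z W : Fin s → Matrix (Fin n) (Fin n) ℝ)
    (hr : ∀ k, ∀ a b : ℝ, (a • Z k + b • W k).rank ≤ R) :
    |⟪Phi s n Z, Phi s n W⟫_ℝ - ⟪AA A Z, AA A W⟫_ℝ| ≤ δ * ‖Phi s n Z‖ * ‖Phi s n W‖ := by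
  refine polar _ _ δ Z W fun a b => ?_
  have := h (a • Z + b • W) (fun k => hr k a b)
  rw [← Phi_norm_sq', AA_norm_sq] at this
  exact this

lemma finner_adj {n m : ℕ} (A : Fin m → Matrix (Fin n) (Fin n) ℝ) (v : Fin m → ℝ)
    (Z : Matrix (Fin n) (Fin n) ℝ) : finner Z (adjA A v) = ∑ p, opA A Z p * v p := by
  simp only [finner, adjA, opA, Matrix.mul_smul, Matrix.trace_smul, Matrix.mul_sum,
    Matrix.trace_sum, smul_eq_mul, Finset.mul_sum]
  refine Finset.sum_congr rfl fun p _ => ?_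
  have : (Zᵀ * A p).trace = ((A p)ᵀ * Z).trace := by
    rw [← Matrix.trace_transpose, Matrix.transpose_mul, Matrix.transpose_transpose]
  rw [this]; ring

lemma sum_finner_adj {s n m : ℕ} (A : Fin s → Fin m → Matrix (Fin n) (Fin n) ℝ)
    (Z W : Fin s → Matrix (Fin n) (Fin n) ℝ) :
    ∑ k, finner (Z k) (adjA (A k) (∑ j, opA (A j) (W j))) = ⟪AA A Z, AA A W⟫_ℝ := by
  simp only [finner_adj, PiLp.inner_apply]
  rw [Finset.sum_comm]
  refine Finset.sum_congr rfl fun p _ => ?_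
  rw [← Finset.sum_mul]
  simp [AA, mul_comm]

lemma adjA_add {n m : ℕ} (A : Fin m → Matrix (Fin n) (Fin n) ℝ) (v w : Fin m → ℝ) :
    adjA A (v + w) = adjA A v + adjA A w := by
  simp [adjA, add_smul, Finset.sum_add_distrib]

lemma adjA_neg {n m : ℕ} (A : Fin m → Matrix (Fin n) (Fin n) ℝ) (v : Fin m → ℝ) :
    adjA A (-v) = -adjA A v := by
  simp [adjA]

lemma mrank_add {n : ℕ} (X Y : Matrix (Fin n) (Fin n) ℝ) :
    (X + Y).rank ≤ X.rank + Y.rank := by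
  have hle : LinearMap.range (X + Y).mulVecLin ≤
      LinearMap.range X.mulVecLin ⊔ LinearMap.range Y.mulVecLin := by
    rintro _ ⟨v, rfl⟩
    rw [Matrix.mulVecLin_apply, Matrix.add_mulVec]
    exact Submodule.add_mem_sup ⟨v, rfl⟩ ⟨v, rfl⟩
  exact (Submodule.finrank_mono hle).trans
    (Submodule.finrank_add_le_finrank_add_finrank _ _)

section
variable {n r : ℕ} (U V : Matrix (Fin n) (Fin r) ℝ)

lemma Pt_add (Z W : Matrix (Fin n) (Fin n) ℝ) : Pt U V (Z + W) = Pt U V Z + Pt U V W := by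
  simp only [Pt, Matrix.mul_add, Matrix.add_mul]; abel

lemma Pt_smul (c : ℝ) (Z : Matrix (Fin n) (Fin n) ℝ) : Pt U V (c • Z) = c • Pt U V Z := by
  simp only [Pt, Matrix.mul_smul, Matrix.smul_mul, smul_add, smul_sub]

lemma Pt_neg (Z : Matrix (Fin n) (Fin n) ℝ) : Pt U V (-Z) = -Pt U V Z := by
  have := Pt_smul U V (-1) Z
  simpa using this

lemma Pt_sub (Z W : Matrix (Fin n) (Fin n) ℝ) : Pt U V (Z - W) = Pt U V Z - Pt U V W := by
  rw [sub_eq_add_neg, Pt_add, Pt_neg, sub_eq_add_neg]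

lemma Pt_compl (Z : Matrix (Fin n) (Fin n) ℝ) :
    Z - Pt U V Z = (1 - U * Uᵀ) * Z * (1 - V * Vᵀ) := by
  simp only [Pt, Matrix.sub_mul, Matrix.mul_sub, Matrix.one_mul, Matrix.mul_one]; abel

lemma Pt_idem (hU : Uᵀ * U = 1) (Z : Matrix (Fin n) (Fin n) ℝ)
    (hV : Vᵀ * V = 1) : Pt U V (Pt U V Z) = Pt U V Z := by
  have h1 : (U * Uᵀ) * (U * Uᵀ) = U * Uᵀ := by
    rw [Matrix.mul_assoc, ← Matrix.mul_assoc Uᵀ, hU, Matrix.one_mul]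
  have h2 : (V * Vᵀ) * (V * Vᵀ) = V * Vᵀ := by
    rw [Matrix.mul_assoc, ← Matrix.mul_assoc Vᵀ, hV, Matrix.one_mul]
  unfold Pt
  generalize U * Uᵀ = P at *
  generalize V * Vᵀ = Q at *
  have h3 : ∀ M, P * (P * M) = P * M := fun M => by rw [← Matrix.mul_assoc, h1]
  simp only [Matrix.add_mul, Matrix.mul_add, Matrix.sub_mul, Matrix.mul_sub, Matrix.mul_assoc,
    h1, h2, h3]
  abel

lemma Pt_symm (Z W : Matrix (Fin n) (Fin n) ℝ) :
    finner (Pt U V Z) W = finner Z (Pt U V W) := by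
  have h1 : (U * Uᵀ)ᵀ = U * Uᵀ := by simp
  have h2 : (V * Vᵀ)ᵀ = V * Vᵀ := by simp
  unfold Pt finner
  generalize U * Uᵀ = P at *
  generalize V * Vᵀ = Q at *
  simp only [Matrix.transpose_add, Matrix.transpose_sub, Matrix.transpose_mul, h1, h2,
    Matrix.add_mul, Matrix.mul_add, Matrix.sub_mul, Matrix.mul_sub, Matrix.trace_add,
    Matrix.trace_sub]
  have e1 : (Q * Zᵀ * W).trace = (Zᵀ * (W * Q)).trace := by
    rw [Matrix.mul_assoc, Matrix.trace_mul_comm, Matrix.mul_assoc]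
  have e2 : (Q * (Zᵀ * P) * W).trace = (Zᵀ * (P * W * Q)).trace := by
    rw [Matrix.mul_assoc, Matrix.trace_mul_comm]; simp only [Matrix.mul_assoc]
  rw [e1, e2]; simp only [Matrix.mul_assoc]

lemma Pt_rank (Z : Matrix (Fin n) (Fin n) ℝ) : (Pt U V Z).rank ≤ 2 * r := by
  have : Pt U V Z = U * (Uᵀ * Z) + (Z - U * Uᵀ * Z) * V * Vᵀ := by
    simp only [Pt, Matrix.sub_mul, Matrix.mul_assoc]; abel
  rw [this]
  have a1 := Matrix.rank_mul_le_left U (Uᵀ * Z)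
  have a2 := Matrix.rank_mul_le_right ((Z - U * Uᵀ * Z) * V) Vᵀ
  have a3 := Matrix.rank_le_width U
  have a4 := Matrix.rank_le_height Vᵀ
  have := mrank_add (U * (Uᵀ * Z)) ((Z - U * Uᵀ * Z) * V * Vᵀ)
  omega
end

lemma le_of_sq_le_sq' {a b : ℝ} (h : a ^ 2 ≤ b ^ 2) (hb : 0 ≤ b) : a ≤ b :=
  (le_abs_self a).trans (abs_le_of_sq_le_sq h hb)

/-- One step of FIHT: the error recursion `E_{l+1} ≤ 2(2δ₂/(1−δ₂) + δ₃/(1−δ₂) + E_l/σ_min)·E_l`. -/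
theorem fiht_one_step
    {n m r s : ℕ}
    (A : Fin s → Fin m → Matrix (Fin n) (Fin n) ℝ)
    (δ₂ δ₃ : ℝ) (hδ₂₃ : δ₂ ≤ δ₃) (hδ₃ : δ₃ < 1)
    (hARIP2 : ARIP (fun k => opA (A k)) (2 * r) δ₂)
    (hARIP3 : ARIP (fun k => opA (A k)) (3 * r) δ₃)
    -- the target matrices, of rank exactly `r`, via their compact SVDs
    (X : Fin s → Matrix (Fin n) (Fin n) ℝ)
    (UX VX : Fin s → Matrix (Fin n) (Fin r) ℝ)
    (SX : Fin s → Matrix (Fin r) (Fin r) ℝ)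
    (hUX : ∀ k, (UX k)ᵀ * UX k = 1) (hVX : ∀ k, (VX k)ᵀ * VX k = 1)
    (hSXdiag : ∀ k i j, i ≠ j → SX k i j = 0) (hSXpos : ∀ k i, 0 < SX k i i)
    (hXsvd : ∀ k, X k = UX k * SX k * (VX k)ᵀ)
    (σmin : ℝ) (hσmin : IsLeast {x : ℝ | ∃ k i, SX k i i = x} σmin)
    (y : Fin m → ℝ) (hy : y = ∑ k, opA (A k) (X k))
    -- the current iterates, of rank exactly `r`, via their SVDs
    (Xl Xnext : Fin s → Matrix (Fin n) (Fin n) ℝ)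
    (U V : Fin s → Matrix (Fin n) (Fin r) ℝ)
    (S : Fin s → Matrix (Fin r) (Fin r) ℝ)
    (hU : ∀ k, (U k)ᵀ * U k = 1) (hV : ∀ k, (V k)ᵀ * V k = 1)
    (hSdiag : ∀ k i j, i ≠ j → S k i j = 0) (hSpos : ∀ k i, 0 < S k i i)
    (hXl : ∀ k, Xl k = U k * S k * (V k)ᵀ)
    (G : Fin s → Matrix (Fin n) (Fin n) ℝ)
    (hG : ∀ k, G k = adjA (A k) (y - ∑ j, opA (A j) (Xl j)))
    (hPt : ∀ k, Pt (U k) (V k) (G k) ≠ 0)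
    (α : Fin s → ℝ)
    (hα : ∀ k, α k = fnorm (Pt (U k) (V k) (G k)) ^ 2 /
        enorm2 (opA (A k) (Pt (U k) (V k) (G k))) ^ 2)
    (hNext : ∀ k, IsBestRankApprox r (Xl k + α k • Pt (U k) (V k) (G k)) (Xnext k)) :
    Real.sqrt (∑ k, fnorm (Xnext k - X k) ^ 2) ≤
      2 * (2 * δ₂ / (1 - δ₂) + δ₃ / (1 - δ₂) +
          Real.sqrt (∑ k, fnorm (Xl k - X k) ^ 2) / σmin) *
        Real.sqrt (∑ k, fnorm (Xl k - X k) ^ 2) := by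
  classical
  obtain ⟨⟨k0, i0, hk0⟩, hleast⟩ := hσmin
  have hσ : 0 < σmin := hk0 ▸ hSXpos k0 i0
  have hσle : ∀ k i, σmin ≤ SX k i i := fun k i => hleast ⟨k, i, rfl⟩
  have h1δ : 0 < 1 - δ₂ := by linarith
  -- single-block ARIP
  have hsingle : ∀ k, ∀ Z : Matrix (Fin n) (Fin n) ℝ, Z.rank ≤ 2 * r →
      (1 - δ₂) * fnorm Z ^ 2 ≤ enorm2 (opA (A k) Z) ^ 2 ∧
      enorm2 (opA (A k) Z) ^ 2 ≤ (1 + δ₂) * fnorm Z ^ 2 := by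
    intro k Z hZ
    have h0 : fnorm (0 : Matrix (Fin n) (Fin n) ℝ) = 0 := by simp [fnorm, finner]
    have := hARIP2 (Pi.single k Z) (fun j => by
      by_cases hj : j = k
      · subst hj; simpa using hZ
      · simp [Pi.single_eq_of_ne hj])
    rw [Finset.sum_eq_single k, Finset.sum_eq_single k] at this
    · simpa using this
    · intro j _ hj
      ext p
      simp [Pi.single_eq_of_ne hj, opA, finner]
    · simp
    · intro j _ hj
      simp [Pi.single_eq_of_ne hj, h0]
    · simp
  have hfpos : ∀ Z : Matrix (Fin n) (Fin n) ℝ, Z ≠ 0 → 0 < fnorm Z ^ 2 := by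
    intro Z hZ
    rw [fnorm_sq]
    refine lt_of_le_of_ne (NN_nonneg Z) fun h => hZ ?_
    ext i j
    have h1 := (Finset.sum_eq_zero_iff_of_nonneg
      (fun i _ => Finset.sum_nonneg fun j _ => sq_nonneg (Z i j))).mp h.symm i (Finset.mem_univ _)
    have h2 := (Finset.sum_eq_zero_iff_of_nonneg
      (fun j _ => sq_nonneg (Z i j))).mp h1 j (Finset.mem_univ _)
    simpa using h2
  have hδ0 : 0 ≤ δ₂ := by
    have h := hsingle k0 _ (Pt_rank (U k0) (V k0) (G k0))
    have := hfpos _ (hPt k0)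
    nlinarith [h.1, h.2]
  have hδ30 : 0 ≤ δ₃ := hδ0.trans hδ₂₃
  -- step sizes
  have hαb : ∀ k, 0 ≤ α k ∧ α k ≤ 1 / (1 - δ₂) ∧ |1 - α k| ≤ δ₂ / (1 - δ₂) := by
    intro k
    have h := hsingle k _ (Pt_rank (U k) (V k) (G k))
    have hp := hfpos _ (hPt k)
    rw [hα k]
    set a := fnorm (Pt (U k) (V k) (G k)) ^ 2
    set b := enorm2 (opA (A k) (Pt (U k) (V k) (G k))) ^ 2
    have hb : 0 < b := lt_of_lt_of_le (mul_pos h1δ hp) h.1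
    have hup : a / b ≤ 1 / (1 - δ₂) := by
      rw [div_le_div_iff₀ hb h1δ]; linarith [h.1]
    have hlo : 1 - δ₂ ≤ a / b := by
      rw [le_div_iff₀ hb]
      nlinarith [h.2, mul_nonneg (sq_nonneg δ₂) hp.le, mul_le_mul_of_nonneg_left h.2 h1δ.le]
    have e1 : 1 / (1 - δ₂) = 1 + δ₂ / (1 - δ₂) := by field_simp; ring
    have e2 : δ₂ ≤ δ₂ / (1 - δ₂) := by
      rw [le_div_iff₀ h1δ]; nlinarith
    refine ⟨by positivity, hup, ?_⟩
    rw [abs_le]; constructor <;> linarith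
  -- set-up
  obtain ⟨D, hD⟩ : ∃ D : Fin s → Matrix (Fin n) (Fin n) ℝ, D = fun k => Xl k - X k := ⟨_, rfl⟩
  obtain ⟨p, hp⟩ : ∃ p : Fin s → Matrix (Fin n) (Fin n) ℝ,
    p = fun k => Pt (U k) (V k) (D k) := ⟨_, rfl⟩
  obtain ⟨q, hq⟩ : ∃ q : Fin s → Matrix (Fin n) (Fin n) ℝ, q = D - p := ⟨_, rfl⟩
  obtain ⟨g1, hg1⟩ : ∃ g : Fin s → Matrix (Fin n) (Fin n) ℝ,
    g = fun k => Pt (U k) (V k) (adjA (A k) (∑ j, opA (A j) (p j))) := ⟨_, rfl⟩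
  obtain ⟨g2, hg2⟩ : ∃ g : Fin s → Matrix (Fin n) (Fin n) ℝ,
    g = fun k => Pt (U k) (V k) (adjA (A k) (∑ j, opA (A j) (q j))) := ⟨_, rfl⟩
  have hDpq : D = p + q := by rw [hq]; abel
  have hPG : ∀ k, Pt (U k) (V k) (G k) = -(g1 k + g2 k) := by
    intro k
    have hv : y - ∑ j, opA (A j) (Xl j)
        = -((∑ j, opA (A j) (p j)) + ∑ j, opA (A j) (q j)) := by
      have e : ∀ j, Xl j = X j + (p j + q j) := by
        intro j
        have : D j = p j + q j := by rw [hDpq]; rfl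
        rw [← this, hD]; simp
      have e2 : ∀ j, opA (A j) (Xl j) = opA (A j) (X j) + (opA (A j) (p j) + opA (A j) (q j)) := by
        intro j
        rw [e j]; ext t
        simp [opA, finner, Matrix.mul_add, mul_add]
      simp only [hy, e2, Finset.sum_add_distrib]
      abel
    rw [hG k, hv, adjA_neg, adjA_add, Pt_neg, Pt_add, hg1, hg2]
  have hT : ∀ k Z, Pt (U k) (V k) (Pt (U k) (V k) Z) = Pt (U k) (V k) Z :=
    fun k Z => Pt_idem _ _ (hU k) Z (hV k)
  have hpT : ∀ k, Pt (U k) (V k) (p k) = p k := fun k => by rw [hp]; exact hT k _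
  have hg1T : ∀ k, Pt (U k) (V k) (g1 k) = g1 k := fun k => by rw [hg1]; exact hT k _
  have hg2T : ∀ k, Pt (U k) (V k) (g2 k) = g2 k := fun k => by rw [hg2]; exact hT k _
  have hqe : ∀ k, q k = (1 - U k * (U k)ᵀ) * D k * (1 - V k * (V k)ᵀ) := by
    intro k
    rw [hq, ← Pt_compl, hp]; rfl
  have hq0 : ∀ k, Pt (U k) (V k) (q k) = 0 := by
    intro k
    have : q k = D k - p k := by rw [hq]; rfl
    rw [this, Pt_sub, hpT, hp, sub_self]
  have hqr : ∀ k, (q k).rank ≤ r := by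
    intro k
    have hL : (1 - U k * (U k)ᵀ) * Xl k = 0 := by
      have : (1 - U k * (U k)ᵀ) * U k = 0 := by
        rw [Matrix.sub_mul, Matrix.mul_assoc, hU]; simp
      rw [hXl, ← Matrix.mul_assoc, ← Matrix.mul_assoc, this]; simp
    have : q k = ((1 - U k * (U k)ᵀ) * (-(UX k * SX k))) * ((VX k)ᵀ * (1 - V k * (V k)ᵀ)) := by
      rw [hqe, hD]
      simp only [Matrix.mul_sub _ (Xl k), hL, zero_sub, hXsvd]
      simp only [Matrix.mul_assoc, Matrix.neg_mul, Matrix.mul_neg]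
    rw [this]
    refine (Matrix.rank_mul_le_left _ _).trans ?_
    exact Matrix.rank_le_width _
  -- analytic estimates
  have hpq : ⟪Phi s n p, Phi s n q⟫_ℝ = 0 := by
    rw [Phi_inner]
    refine Finset.sum_eq_zero fun k _ => ?_
    rw [← hpT k, Pt_symm, hq0]; simp [finner]
  have hg2q : ⟪Phi s n g2, Phi s n q⟫_ℝ = 0 := by
    rw [Phi_inner]
    refine Finset.sum_eq_zero fun k _ => ?_
    rw [← hg2T k, Pt_symm, hq0]; simp [finner]
  have hpyth : ‖Phi s n D‖ ^ 2 = ‖Phi s n p‖ ^ 2 + ‖Phi s n q‖ ^ 2 := by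
    rw [hDpq, map_add, norm_add_sq_real, hpq]; ring
  have hpD : ‖Phi s n p‖ ≤ ‖Phi s n D‖ :=
    le_of_sq_le_sq' (by nlinarith [sq_nonneg ‖Phi s n q‖]) (norm_nonneg _)
  have hqD : ‖Phi s n q‖ ≤ ‖Phi s n D‖ :=
    le_of_sq_le_sq' (by nlinarith [sq_nonneg ‖Phi s n p‖]) (norm_nonneg _)
  have cancel : ∀ x c : ℝ, 0 ≤ x → 0 ≤ c → x ^ 2 ≤ c * x → x ≤ c := by
    intro x c hx hc h
    by_contra hlt
    push Not at hlt
    nlinarith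
  have est1 : ‖Phi s n (p - g1)‖ ≤ δ₂ * ‖Phi s n p‖ := by
    refine cancel _ _ (norm_nonneg _) (by positivity) ?_
    have hzT : ∀ k, Pt (U k) (V k) ((p - g1) k) = (p - g1) k := by
      intro k
      rw [Pi.sub_apply, Pt_sub, hpT, hg1T]
    have hb := arip_polar A δ₂ hARIP2 (p - g1) p (fun k a b => by
      rw [← hzT k, ← hpT k, ← Pt_smul, ← Pt_smul, ← Pt_add]
      exact Pt_rank _ _ _)
    have hin : ⟪Phi s n (p - g1), Phi s n g1⟫_ℝ = ⟪AA A (p - g1), AA A p⟫_ℝ := by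
      rw [Phi_inner, ← sum_finner_adj]
      refine Finset.sum_congr rfl fun k _ => ?_
      conv_rhs => rw [← hzT k, Pt_symm]
      rw [hg1]
    have : ‖Phi s n (p - g1)‖ ^ 2
        = ⟪Phi s n (p - g1), Phi s n p⟫_ℝ - ⟪Phi s n (p - g1), Phi s n g1⟫_ℝ := by
      rw [← inner_sub_right, ← map_sub, real_inner_self_eq_norm_sq]
    rw [this, hin]
    refine (le_abs_self _).trans (hb.trans (le_of_eq (by ring)))
  have est2 : ‖Phi s n g2‖ ≤ δ₃ * ‖Phi s n q‖ := by
    refine cancel _ _ (norm_nonneg _) (by positivity) ?_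
    have hb := arip_polar A δ₃ hARIP3 g2 q (fun k a b => by
      have h1 := mrank_add (a • g2 k) (b • q k)
      have h2 : (a • g2 k).rank ≤ 2 * r := by
        rw [← hg2T k, ← Pt_smul]; exact Pt_rank _ _ _
      have h3 : (b • q k).rank ≤ r := by
        have : b • q k = (b • (1 : Matrix (Fin n) (Fin n) ℝ)) * q k := by simp
        rw [this]
        exact (Matrix.rank_mul_le_right _ _).trans (hqr k)
      omega)
    have hin : ⟪Phi s n g2, Phi s n g2⟫_ℝ = ⟪AA A g2, AA A q⟫_ℝ := by
      rw [Phi_inner, ← sum_finner_adj]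
      refine Finset.sum_congr rfl fun k _ => ?_
      conv_rhs => rw [← hg2T k, Pt_symm]
      conv_lhs => arg 2; rw [hg2]
    rw [hg2q, zero_sub, abs_neg] at hb
    rw [← real_inner_self_eq_norm_sq, hin]
    refine (le_abs_self _).trans (hb.trans (le_of_eq (by ring)))
  have est3 : ‖Phi s n q‖ ≤ ‖Phi s n D‖ ^ 2 / σmin := by
    refine le_of_sq_le_sq' ?_ (by positivity)
    rw [Phi_norm_sq, Phi_norm_sq]
    calc ∑ k, NN (q k) ≤ ∑ k, (NN (D k) / σmin) ^ 2 := by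
          refine Finset.sum_le_sum fun k _ => ?_
          rw [hqe]
          refine tangent_est (X k) (D k) (UX k) (VX k) (U k) (V k) (SX k) (S k) (hUX k) (hVX k)
            (hSXdiag k) σmin hσ (hσle k) (hXsvd k) (hU k) (hV k) ?_
          rw [hD, ← hXl]
      _ ≤ (∑ k, NN (D k) / σmin) ^ 2 :=
          Finset.sum_sq_le_sq_sum_of_nonneg fun k _ => div_nonneg (NN_nonneg _) hσ.le
      _ = _ := by rw [Finset.sum_div]
  have scale : ∀ (β : Fin s → ℝ) (c : ℝ) (Z : Fin s → Matrix (Fin n) (Fin n) ℝ), 0 ≤ c →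
      (∀ k, |β k| ≤ c) → ‖Phi s n (fun k => β k • Z k)‖ ≤ c * ‖Phi s n Z‖ := by
    intro β c Z hc hβ
    refine le_of_sq_le_sq' ?_ (by positivity)
    rw [mul_pow, Phi_norm_sq, Phi_norm_sq, Finset.mul_sum]
    refine Finset.sum_le_sum fun k _ => ?_
    have : NN (β k • Z k) = β k ^ 2 * NN (Z k) := by
      simp [NN, Finset.mul_sum, mul_pow]
    rw [this]
    refine mul_le_mul_of_nonneg_right ?_ (NN_nonneg _)
    exact sq_le_sq' (by linarith [neg_abs_le (β k), hβ k]) ((le_abs_self _).trans (hβ k))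
  -- combine
  obtain ⟨W, hW⟩ : ∃ W : Fin s → Matrix (Fin n) (Fin n) ℝ,
    W = fun k => Xl k + α k • Pt (U k) (V k) (G k) - X k := ⟨_, rfl⟩
  have hWdec : W = (p - g1) + (fun k => (1 - α k) • g1 k) + (fun k => (-α k) • g2 k) + q := by
    funext k
    have e : Xl k = X k + (p k + q k) := by
      have : D k = p k + q k := by rw [hDpq]; rfl
      rw [← this, hD]; simp
    simp only [hW, Pi.add_apply, Pi.sub_apply, hPG, e, sub_smul, one_smul, smul_neg, smul_add,
      neg_smul]
    abel
  have hg1n : ‖Phi s n g1‖ ≤ (1 + δ₂) * ‖Phi s n p‖ := by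
    have : Phi s n g1 = Phi s n p - Phi s n (p - g1) := by rw [map_sub]; abel
    rw [this]
    refine (norm_sub_le _ _).trans ?_
    linarith
  have hWn : ‖Phi s n W‖ ≤ (2 * δ₂ / (1 - δ₂) + δ₃ / (1 - δ₂) + ‖Phi s n D‖ / σmin)
      * ‖Phi s n D‖ := by
    have b2 := scale (fun k => 1 - α k) (δ₂ / (1 - δ₂)) g1 (by positivity) (fun k => (hαb k).2.2)
    have b3 := scale (fun k => -α k) (1 / (1 - δ₂)) g2 (by positivity) (fun k => by
      rw [abs_neg, abs_of_nonneg (hαb k).1]; exact (hαb k).2.1)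
    have b4 : ‖Phi s n W‖ ≤ ‖Phi s n (p - g1)‖ + ‖Phi s n (fun k => (1 - α k) • g1 k)‖
        + ‖Phi s n (fun k => (-α k) • g2 k)‖ + ‖Phi s n q‖ := by
      rw [hWdec, map_add, map_add, map_add]
      exact norm_add₄_le
    have c1 : δ₂ * ‖Phi s n p‖ + δ₂ / (1 - δ₂) * ((1 + δ₂) * ‖Phi s n p‖)
        = 2 * δ₂ / (1 - δ₂) * ‖Phi s n p‖ := by field_simp; ring
    have c2 : δ₂ / (1 - δ₂) * ‖Phi s n g1‖ ≤ δ₂ / (1 - δ₂) * ((1 + δ₂) * ‖Phi s n p‖) := by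
      gcongr
    have c3 : 2 * δ₂ / (1 - δ₂) * ‖Phi s n p‖ ≤ 2 * δ₂ / (1 - δ₂) * ‖Phi s n D‖ := by gcongr
    have c4 : 1 / (1 - δ₂) * ‖Phi s n g2‖ ≤ 1 / (1 - δ₂) * (δ₃ * ‖Phi s n D‖) := by
      gcongr
      exact est2.trans (by gcongr)
    have c5 : (2 * δ₂ / (1 - δ₂) + δ₃ / (1 - δ₂) + ‖Phi s n D‖ / σmin) * ‖Phi s n D‖
        = 2 * δ₂ / (1 - δ₂) * ‖Phi s n D‖ + 1 / (1 - δ₂) * (δ₃ * ‖Phi s n D‖)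
          + ‖Phi s n D‖ ^ 2 / σmin := by ring
    rw [c5]
    linarith
  have hXr : ∀ k, (X k).rank ≤ r := by
    intro k
    rw [hXsvd]
    exact (Matrix.rank_mul_le_left _ _).trans (Matrix.rank_le_width _)
  have hfin : Real.sqrt (∑ k, fnorm (Xnext k - X k) ^ 2) ≤ 2 * ‖Phi s n W‖ := by
    refine Real.sqrt_le_iff.mpr ⟨by positivity, ?_⟩
    rw [mul_pow, Phi_norm_sq', Finset.mul_sum]
    refine Finset.sum_le_sum fun k _ => ?_
    rw [← mul_pow]
    have h1 := fnorm_tri (Xnext k) (Xl k + α k • Pt (U k) (V k) (G k)) (X k)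
    have h2 := (hNext k).2 (X k) (hXr k)
    have h3 : fnorm (X k - (Xl k + α k • Pt (U k) (V k) (G k))) = fnorm (W k) := by
      have : X k - (Xl k + α k • Pt (U k) (V k) (G k)) = -W k := by rw [hW]; simp
      rw [this]; simp [fnorm, finner]
    have h4 : 0 ≤ fnorm (Xnext k - X k) := Real.sqrt_nonneg _
    gcongr
    linarith
  have hDn : Real.sqrt (∑ k, fnorm (Xl k - X k) ^ 2) = ‖Phi s n D‖ := by
    rw [← Phi_norm, hD]
  rw [hDn]
  linarith
end
end

section
/- Let X_l ∈ ℝ^{n×n} be a matrix of rank exactly r with tangent space T, and let X ∈ ℝ^{n×n} be another matrix of rank exactly r. Then ‖X − P_T(X)‖_F ≤ ‖X_l − X‖_F² / σ_min(X), where σ_min(X) denotes the r-th (smallest nonzero) singular value of X. -/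
open Matrix MeasureTheory ProbabilityTheory Finset

noncomputable section

attribute [local instance] Matrix.frobeniusNormedAddCommGroup

lemma fro_sq {m k : ℕ} (M : Matrix (Fin m) (Fin k) ℝ) : ‖M‖ ^ 2 = (Mᵀ * M).trace := by
  rw [Matrix.frobenius_norm_def, ← Real.sqrt_eq_rpow, Real.sq_sqrt (by positivity)]
  simp only [Matrix.trace, Matrix.diag, Matrix.mul_apply, Matrix.transpose_apply]
  rw [Finset.sum_comm]
  refine Finset.sum_congr rfl fun i _ => Finset.sum_congr rfl fun j _ => ?_
  simp [sq]

lemma fnorm_eq {n : ℕ} (M : Matrix (Fin n) (Fin n) ℝ) : fnorm M = ‖M‖ := by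
  rw [fnorm, finner, ← fro_sq, Real.sqrt_sq (norm_nonneg _)]

lemma fro_tr {m k : ℕ} (M : Matrix (Fin m) (Fin k) ℝ) : ‖Mᵀ‖ = ‖M‖ :=
  Matrix.frobenius_norm_transpose M

lemma fro_proj {n r k : ℕ} (U : Matrix (Fin n) (Fin r) ℝ) (hU : Uᵀ * U = 1)
    (M : Matrix (Fin n) (Fin k) ℝ) : ‖(1 - U * Uᵀ) * M‖ ≤ ‖M‖ := by
  have h : ‖(1 - U * Uᵀ) * M‖ ^ 2 = ‖M‖ ^ 2 - ‖Uᵀ * M‖ ^ 2 := by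
    rw [fro_sq, fro_sq, fro_sq, ← Matrix.trace_sub]
    congr 1
    have h1 : (1 - U * Uᵀ) * (1 - U * Uᵀ) = 1 - U * Uᵀ := by
      have : U * Uᵀ * (U * Uᵀ) = U * Uᵀ := by
        rw [Matrix.mul_assoc, ← Matrix.mul_assoc Uᵀ, hU, Matrix.one_mul]
      rw [Matrix.mul_sub, Matrix.sub_mul, Matrix.sub_mul, this]
      simp
    have h2 : (1 - U * Uᵀ)ᵀ = 1 - U * Uᵀ := by simp
    rw [Matrix.transpose_mul, h2, Matrix.mul_assoc, ← Matrix.mul_assoc (1 - U * Uᵀ), h1]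
    simp [Matrix.sub_mul, Matrix.mul_sub, Matrix.mul_assoc]
  exact abs_le_of_sq_le_sq' (by nlinarith [sq_nonneg ‖Uᵀ * M‖]) (norm_nonneg _) |>.2

lemma fro_iso {n r k : ℕ} (W : Matrix (Fin n) (Fin r) ℝ) (hW : Wᵀ * W = 1)
    (M : Matrix (Fin r) (Fin k) ℝ) : ‖W * M‖ = ‖M‖ := by
  have h : ‖W * M‖ ^ 2 = ‖M‖ ^ 2 := by
    rw [fro_sq, fro_sq, Matrix.transpose_mul, Matrix.mul_assoc, ← Matrix.mul_assoc Wᵀ, hW,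
      Matrix.one_mul]
  exact (sq_eq_sq₀ (norm_nonneg _) (norm_nonneg _)).1 h

lemma fro_diag {r k : ℕ} (s : Fin r → ℝ) (σ : ℝ) (h0 : 0 < σ) (hs : ∀ i, σ ≤ s i)
    (B : Matrix (Fin r) (Fin k) ℝ) : σ * ‖B‖ ≤ ‖Matrix.diagonal s * B‖ := by
  have h : (σ * ‖B‖) ^ 2 ≤ ‖Matrix.diagonal s * B‖ ^ 2 := by
    rw [mul_pow, fro_sq, fro_sq]
    simp only [Matrix.trace, Matrix.diag, Matrix.mul_apply (M := Bᵀ),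
      Matrix.mul_apply (M := (Matrix.diagonal s * B)ᵀ), Matrix.transpose_apply,
      Matrix.diagonal_mul, Finset.mul_sum]
    refine Finset.sum_le_sum fun i _ => Finset.sum_le_sum fun j _ => ?_
    have := mul_le_mul_of_nonneg_right (pow_le_pow_left₀ h0.le (hs j) 2) (sq_nonneg (B j i))
    nlinarith
  exact (abs_le_of_sq_le_sq' h (norm_nonneg _)).2

/-- **Lemma 2**: `‖(I − P_T)(X)‖_F ≤ ‖X_l − X‖_F² / σ_min(X)`. -/
theorem tangent_projection_bound
    {n r : ℕ}
    (Xl : Matrix (Fin n) (Fin n) ℝ)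
    (U V : Matrix (Fin n) (Fin r) ℝ) (S : Matrix (Fin r) (Fin r) ℝ)
    (hU : Uᵀ * U = 1) (hV : Vᵀ * V = 1)
    (hSdiag : ∀ i j, i ≠ j → S i j = 0) (hSpos : ∀ i, 0 < S i i)
    (hXl : Xl = U * S * Vᵀ)
    (X : Matrix (Fin n) (Fin n) ℝ)
    (UX VX : Matrix (Fin n) (Fin r) ℝ) (SX : Matrix (Fin r) (Fin r) ℝ)
    (hUX : UXᵀ * UX = 1) (hVX : VXᵀ * VX = 1)
    (hSXdiag : ∀ i j, i ≠ j → SX i j = 0) (hSXpos : ∀ i, 0 < SX i i)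
    (hX : X = UX * SX * VXᵀ)
    (σmin : ℝ) (hσmin : IsLeast {x : ℝ | ∃ i, SX i i = x} σmin) :
    fnorm (X - Pt U V X) ≤ fnorm (Xl - X) ^ 2 / σmin := by
  obtain ⟨⟨i0, hi0⟩, hmin⟩ := hσmin
  have h0 : 0 < σmin := hi0 ▸ hSXpos i0
  have hs : ∀ i, σmin ≤ SX i i := fun i => hmin ⟨i, rfl⟩
  have hD : SX = Matrix.diagonal (fun i => SX i i) := by
    ext i j
    by_cases h : i = j
    · subst h; simp
    · rw [Matrix.diagonal_apply_ne _ h, hSXdiag i j h]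
  have hSt : SXᵀ = SX := by rw [hD]; simp
  have e1 : X - Pt U V X = ((1 - U * Uᵀ) * UX * SX) * (VXᵀ * (1 - V * Vᵀ)) := by
    have : X - Pt U V X = (1 - U * Uᵀ) * X * (1 - V * Vᵀ) := by
      simp only [Pt, Matrix.sub_mul, Matrix.mul_sub, Matrix.one_mul, Matrix.mul_one]
      abel
    rw [this, hX]; simp only [Matrix.mul_assoc]
  have z1 : (1 - U * Uᵀ) * Xl = 0 := by
    rw [hXl, Matrix.sub_mul, Matrix.one_mul, Matrix.mul_assoc U, Matrix.mul_assoc U,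
      ← Matrix.mul_assoc Uᵀ, hU, Matrix.one_mul, sub_self]
  have z2 : (1 - V * Vᵀ) * Xlᵀ = 0 := by
    rw [hXl, Matrix.transpose_mul, Matrix.transpose_transpose, Matrix.sub_mul, Matrix.one_mul,
      Matrix.mul_assoc V, ← Matrix.mul_assoc Vᵀ, hV, Matrix.one_mul, sub_self]
  have b1 : ‖(1 - U * Uᵀ) * UX * SX‖ ≤ ‖Xl - X‖ := by
    rw [← fro_tr, ← fro_iso VX hVX, ← fro_tr]
    have : (VX * ((1 - U * Uᵀ) * UX * SX)ᵀ)ᵀ = -((1 - U * Uᵀ) * (Xl - X)) := by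
      rw [Matrix.mul_sub, z1, hX, Matrix.transpose_mul, Matrix.transpose_transpose]
      simp only [Matrix.mul_assoc, zero_sub, neg_neg]
    rw [this, norm_neg]
    exact fro_proj U hU _
  have b2 : ‖SX * (VXᵀ * (1 - V * Vᵀ))‖ ≤ ‖Xl - X‖ := by
    rw [← fro_iso UX hUX, ← fro_tr, ← fro_tr (Xl - X)]
    have : (UX * (SX * (VXᵀ * (1 - V * Vᵀ))))ᵀ = -((1 - V * Vᵀ) * (Xl - X)ᵀ) := by
      have h2 : (1 - V * Vᵀ)ᵀ = 1 - V * Vᵀ := by simp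
      rw [Matrix.transpose_sub, Matrix.mul_sub _ Xlᵀ, z2, hX]
      simp only [Matrix.transpose_mul, h2, Matrix.transpose_transpose, Matrix.mul_assoc,
        zero_sub, neg_neg]
    rw [this, norm_neg]
    exact fro_proj V hV _
  have b3 : σmin * ‖VXᵀ * (1 - V * Vᵀ)‖ ≤ ‖SX * (VXᵀ * (1 - V * Vᵀ))‖ := by
    have := fro_diag (fun i => SX i i) σmin h0 hs (VXᵀ * (1 - V * Vᵀ))
    rwa [← hD] at this
  rw [fnorm_eq, fnorm_eq, le_div_iff₀ h0, e1]
  have b4 := Matrix.frobenius_norm_mul ((1 - U * Uᵀ) * UX * SX) (VXᵀ * (1 - V * Vᵀ))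
  calc _ ≤ ‖(1 - U * Uᵀ) * UX * SX‖ * ‖VXᵀ * (1 - V * Vᵀ)‖ * σmin :=
        mul_le_mul_of_nonneg_right b4 h0.le
    _ = ‖(1 - U * Uᵀ) * UX * SX‖ * (σmin * ‖VXᵀ * (1 - V * Vᵀ)‖) := by ring
    _ ≤ ‖Xl - X‖ * ‖Xl - X‖ :=
        mul_le_mul b1 (b3.trans b2) (by positivity) (norm_nonneg _)
    _ = ‖Xl - X‖ ^ 2 := by ring
end
end

section
/- Let M be a 2r×2r Hermitian complex matrix of block form M = [[A, B],[Bᴴ, 0]], where A is an r×r Hermitian matrix, B is an r×r matrix, and the lower-right r×r block is zero. Then M has at most r positive eigenvalues, counted with multiplicity. -/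
open Matrix MeasureTheory ProbabilityTheory Finset

noncomputable section

/-- A Hermitian matrix of block form `[[A, B], [Bᴴ, 0]]` has at most `r` positive
eigenvalues (with multiplicity). -/
theorem block_hermitian_pos_eigenvalues
    {r : ℕ} (A B : Matrix (Fin r) (Fin r) ℂ) (hA : A.IsHermitian)
    (M : Matrix (Fin r ⊕ Fin r) (Fin r ⊕ Fin r) ℂ)
    (hM : M = Matrix.fromBlocks A B Bᴴ 0)
    (hMh : M.IsHermitian) :
    (Finset.univ.filter fun i => 0 < hMh.eigenvalues i).card ≤ r := by
  set S := Finset.univ.filter fun i => 0 < hMh.eigenvalues i with hS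
  let v := hMh.eigenvectorBasis
  let t : Fin r ⊕ Fin r → Fin r → ℂ := fun i k => v i (Sum.inl k)
  have hli : LinearIndepOn ℂ t (S : Set (Fin r ⊕ Fin r)) := by
    rw [linearIndepOn_finset_iff]
    intro g hg
    let l₂ : Fin r ⊕ Fin r → ℂ := fun i => g i * (hMh.eigenvalues i : ℂ)
    have h1 := v.orthonormal.inner_sum g l₂ S
    have hx : ∀ k, (∑ i ∈ S, g i • v i) (Sum.inl k) = 0 := by
      intro k
      have := congrFun hg k
      simpa [t, Finset.sum_apply] using this
    have hy : ∀ k, (∑ i ∈ S, l₂ i • v i) (Sum.inr k) = 0 := by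
      intro k
      have h2 : ∀ i, l₂ i * v i (Sum.inr k) = ∑ j, (Bᴴ k j) * (g i * v i (Sum.inl j)) := by
        intro i
        have h3 := congrFun (hMh.mulVec_eigenvectorBasis i) (Sum.inr k)
        simp only [Matrix.mulVec, dotProduct, Fintype.sum_sum_type] at h3
        have e1 : ∀ a, M (Sum.inr k) (Sum.inl a) = Bᴴ k a := fun a => by rw [hM]; rfl
        have e2 : ∀ a, M (Sum.inr k) (Sum.inr a) = 0 := fun a => by rw [hM]; rfl
        simp only [e1, e2, zero_mul, Finset.sum_const_zero, add_zero, Pi.smul_apply, Complex.real_smul] at h3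
        simp only [l₂]
        rw [mul_assoc, ← h3, Finset.mul_sum]
        exact Finset.sum_congr rfl fun j _ => by ring
      have h4 : ∀ j, ∑ i ∈ S, g i * v i (Sum.inl j) = 0 := fun j => by simpa using hx j
      simp only [WithLp.ofLp_sum, WithLp.ofLp_smul, Finset.sum_apply, Pi.smul_apply, smul_eq_mul]
      rw [Finset.sum_congr rfl fun i _ => h2 i, Finset.sum_comm]
      simp [← Finset.mul_sum, h4]
    have h0 : inner ℂ (∑ i ∈ S, g i • v i) (∑ i ∈ S, l₂ i • v i) = 0 := by
      rw [PiLp.inner_apply, Fintype.sum_sum_type]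
      simp only [hx, hy, inner_zero_left, inner_zero_right, Finset.sum_const_zero, add_zero]
    rw [h0] at h1
    have h5 : ∑ i ∈ S, hMh.eigenvalues i * Complex.normSq (g i) = 0 := by
      have : ((∑ i ∈ S, hMh.eigenvalues i * Complex.normSq (g i) : ℝ) : ℂ) = 0 := by
        rw [h1]
        push_cast
        refine Finset.sum_congr rfl fun i _ => ?_
        rw [Complex.normSq_eq_conj_mul_self]
        simp only [l₂]
        ring
      exact_mod_cast this
    have hpos : ∀ i ∈ S, 0 < hMh.eigenvalues i := fun i hi => (Finset.mem_filter.mp hi).2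
    rw [Finset.sum_eq_zero_iff_of_nonneg
      (fun i hi => mul_nonneg (hpos i hi).le (Complex.normSq_nonneg _))] at h5
    intro i hi
    rcases mul_eq_zero.mp (h5 i hi) with h | h
    · exact absurd h (hpos i hi).ne'
    · exact Complex.normSq_eq_zero.mp h
  have := LinearIndependent.fintype_card_le_finrank hli
  simpa using this
end
end

section
/- Let Z ∈ ℝ^{n×n} be a matrix of rank at most 2r. Then Z can be written as Z = Y¹ + Y² where rank(Y¹) ≤ r, rank(Y²) ≤ r, (Y¹)ᵀY² = 0, Y¹(Y²)ᵀ = 0 (hence ⟨Y¹, Y²⟩ = 0 in the Frobenius inner product), and ‖Y¹‖_F² + ‖Y²‖_F² = ‖Z‖_F². -/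
open Matrix MeasureTheory ProbabilityTheory Finset

noncomputable section

lemma split_aux {n : ℕ} (Z : Matrix (Fin n) (Fin n) ℝ) :
    ∃ (V : Matrix (Fin n) (Fin n) ℝ) (d : Fin n → ℝ), V * Vᵀ = 1 ∧ Vᵀ * V = 1 ∧
      Vᵀ * (Zᵀ * Z) * V = diagonal d ∧ Z.rank = (univ.filter (fun i => d i ≠ 0)).card := by
  have h : (Zᵀ * Z).IsHermitian := by
    simpa using Matrix.isHermitian_conjTranspose_mul_self Z
  have h1 := (Matrix.mem_unitaryGroup_iff).1 h.eigenvectorUnitary.2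
  have h2 := (Matrix.mem_unitaryGroup_iff').1 h.eigenvectorUnitary.2
  have hs : star (h.eigenvectorUnitary : Matrix (Fin n) (Fin n) ℝ)
      = (h.eigenvectorUnitary : Matrix (Fin n) (Fin n) ℝ)ᵀ := by
    ext i j; simp [Matrix.star_apply]
  rw [hs] at h1 h2
  have h3 : (h.eigenvectorUnitary : Matrix (Fin n) (Fin n) ℝ)ᵀ * (Zᵀ * Z) *
      (h.eigenvectorUnitary : Matrix (Fin n) (Fin n) ℝ) = diagonal h.eigenvalues := by
    have := h.conjStarAlgAut_star_eigenvectorUnitary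
    have hs' : star (h.eigenvectorUnitary : Matrix (Fin n) (Fin n) ℝ)ᵀ
        = (h.eigenvectorUnitary : Matrix (Fin n) (Fin n) ℝ) := by
      rw [← hs, star_star]
    simpa [Unitary.conjStarAlgAut_apply, hs, hs', Function.comp_def] using this
  refine ⟨h.eigenvectorUnitary, h.eigenvalues, h1, h2, h3, ?_⟩
  rw [← Matrix.rank_transpose_mul_self, h.rank_eq_card_non_zero_eigs, Fintype.card_subtype]

lemma mul_aux {n : ℕ} {Z V : Matrix (Fin n) (Fin n) ℝ} {d : Fin n → ℝ}
    (h3 : Vᵀ * (Zᵀ * Z) * V = diagonal d) (p q : Fin n → ℝ) :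
    (Z * V * diagonal p * Vᵀ)ᵀ * (Z * V * diagonal q * Vᵀ) =
      V * diagonal (fun i => p i * d i * q i) * Vᵀ := by
  have : (Z * V * diagonal p * Vᵀ)ᵀ * (Z * V * diagonal q * Vᵀ) =
      V * (diagonal p * (Vᵀ * (Zᵀ * Z) * V) * diagonal q) * Vᵀ := by
    simp only [transpose_mul, transpose_transpose, diagonal_transpose, Matrix.mul_assoc]
  rw [this, h3, diagonal_mul_diagonal, diagonal_mul_diagonal]

lemma rank_aux {n : ℕ} {Z V : Matrix (Fin n) (Fin n) ℝ} {d : Fin n → ℝ}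
    (h3 : Vᵀ * (Zᵀ * Z) * V = diagonal d) (p : Fin n → ℝ) (T : Finset (Fin n))
    (hT : ∀ i, p i ≠ 0 → d i ≠ 0 → i ∈ T) :
    (Z * V * diagonal p * Vᵀ).rank ≤ T.card := by
  rw [← Matrix.rank_transpose_mul_self, mul_aux h3]
  refine (Matrix.rank_mul_le_left _ _).trans ((Matrix.rank_mul_le_right _ _).trans ?_)
  rw [Matrix.rank_diagonal, Fintype.card_subtype]
  refine Finset.card_le_card fun i hi => ?_
  simp only [Finset.mem_filter, Finset.mem_univ, true_and, ne_eq, mul_eq_zero, not_or] at hi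
  exact hT i hi.1.1 hi.1.2

/-- A rank-`≤ 2r` matrix splits into two orthogonal pieces of rank at most `r`. -/
theorem rank_two_r_split
    {n r : ℕ} (Z : Matrix (Fin n) (Fin n) ℝ) (hZ : Z.rank ≤ 2 * r) :
    ∃ Y₁ Y₂ : Matrix (Fin n) (Fin n) ℝ,
      Z = Y₁ + Y₂ ∧ Y₁.rank ≤ r ∧ Y₂.rank ≤ r ∧
      Y₁ᵀ * Y₂ = 0 ∧ Y₁ * Y₂ᵀ = 0 ∧ finner Y₁ Y₂ = 0 ∧
      fnorm Y₁ ^ 2 + fnorm Y₂ ^ 2 = fnorm Z ^ 2 := by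
  classical
  obtain ⟨V, d, h1, h2, h3, hr⟩ := split_aux Z
  set S := univ.filter (fun i => d i ≠ 0) with hS
  obtain ⟨T, hTS, hT⟩ := Finset.exists_subset_card_eq (s := S) (n := min r S.card) (min_le_right _ _)
  set p : Fin n → ℝ := fun i => if i ∈ T then 1 else 0 with hp
  set q : Fin n → ℝ := fun i => if i ∈ T then 0 else 1 with hq
  have hsum : Z = Z * V * diagonal p * Vᵀ + Z * V * diagonal q * Vᵀ := by
    rw [← Matrix.add_mul, ← Matrix.mul_add, diagonal_add]
    have : (fun i => p i + q i) = fun _ => (1 : ℝ) := by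
      funext i; simp only [hp, hq]; split_ifs <;> simp
    rw [this, diagonal_one, Matrix.mul_one, Matrix.mul_assoc, h1, Matrix.mul_one]
  have ho : (Z * V * diagonal p * Vᵀ)ᵀ * (Z * V * diagonal q * Vᵀ) = 0 := by
    rw [mul_aux h3]
    have : (fun i => p i * d i * q i) = fun _ => (0 : ℝ) := by
      funext i; simp only [hp, hq]; split_ifs <;> simp
    rw [this, diagonal_zero]; simp
  have ho' : (Z * V * diagonal p * Vᵀ) * (Z * V * diagonal q * Vᵀ)ᵀ = 0 := by
    have : (Z * V * diagonal p * Vᵀ) * (Z * V * diagonal q * Vᵀ)ᵀ =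
        Z * V * (diagonal p * (Vᵀ * V) * diagonal q) * (Vᵀ * Zᵀ) := by
      simp only [transpose_mul, transpose_transpose, diagonal_transpose, Matrix.mul_assoc]
    have h0 : (fun i => p i * q i) = fun _ => (0 : ℝ) := by
      funext i; simp only [hp, hq]; split_ifs <;> simp
    rw [this, h2, Matrix.mul_one, diagonal_mul_diagonal, h0, diagonal_zero]; simp
  have hr1 : (Z * V * diagonal p * Vᵀ).rank ≤ r := by
    refine (rank_aux h3 p T fun i hi _ => ?_).trans (hT ▸ min_le_left _ _)
    by_contra hc
    simp [hp, hc] at hi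
  have hr2 : (Z * V * diagonal q * Vᵀ).rank ≤ r := by
    refine (rank_aux h3 q (S \ T) fun i hi hd => ?_).trans ?_
    · have : i ∉ T := fun hc => by simp [hq, hc] at hi
      simp [hS, hd, this]
    · rw [Finset.card_sdiff_of_subset hTS]; omega
  generalize Z * V * diagonal p * Vᵀ = Y₁ at *
  generalize Z * V * diagonal q * Vᵀ = Y₂ at *
  refine ⟨Y₁, Y₂, hsum, hr1, hr2, ho, ho', by simp [finner, ho], ?_⟩
  have hnn : ∀ X : Matrix (Fin n) (Fin n) ℝ, 0 ≤ finner X X := fun X => by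
    simp only [finner, Matrix.trace, Matrix.diag, Matrix.mul_apply, transpose_apply]
    exact Finset.sum_nonneg fun i _ => Finset.sum_nonneg fun j _ => mul_self_nonneg _
  have ho2 : Y₂ᵀ * Y₁ = 0 := by
    simpa using congrArg Matrix.transpose ho
  simp only [fnorm, Real.sq_sqrt (hnn _)]
  rw [hsum]
  simp [finner, Matrix.add_mul, Matrix.mul_add, ho, ho2]
end
end

section
/- Let W ∈ ℝ^{n×n}, let X ∈ ℝ^{n×n} have rank at most r, and let X' be a best rank-r approximation of W, i.e., rank(X') ≤ r and ‖X' − W‖_F ≤ ‖Z − W‖_F for every matrix Z of rank at most r. Let Q ∈ ℝ^{n×t} have orthonormal columns (QᵀQ = I) such that the column spaces of X' and of X are both contained in the column space of Q. Then ‖X' − QQᵀW‖_F ≤ ‖X − QQᵀW‖_F. -/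
open Matrix MeasureTheory ProbabilityTheory Finset

noncomputable section

/-- The best rank-`r` approximation of `W` is also the closest among rank-`≤ r`
matrices to the projection `QQᵀW`, for any orthonormal `Q` whose column space
contains the column spaces of `X'` and `X`. -/
theorem best_approx_projected
    {n r t : ℕ} (W X X' : Matrix (Fin n) (Fin n) ℝ)
    (hX : X.rank ≤ r) (hX' : IsBestRankApprox r W X')
    (Q : Matrix (Fin n) (Fin t) ℝ) (hQ : Qᵀ * Q = 1)
    (hX'col : ∃ M : Matrix (Fin t) (Fin n) ℝ, X' = Q * M)
    (hXcol : ∃ M : Matrix (Fin t) (Fin n) ℝ, X = Q * M) :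
    fnorm (X' - Q * Qᵀ * W) ≤ fnorm (X - Q * Qᵀ * W) := by
  obtain ⟨M', rfl⟩ := hX'col
  obtain ⟨M, rfl⟩ := hXcol
  have key : ∀ N : Matrix (Fin t) (Fin n) ℝ, finner (Q * N - W) (Q * N - W) =
      finner (Q * N - Q * Qᵀ * W) (Q * N - Q * Qᵀ * W) + (Wᵀ * W - Wᵀ * Q * Qᵀ * W).trace := by
    intro N
    have c : ∀ B : Matrix (Fin t) (Fin n) ℝ, Qᵀ * (Q * B) = B := fun B => by
      rw [← Matrix.mul_assoc, hQ, Matrix.one_mul]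
    unfold finner
    rw [← Matrix.trace_add]
    congr 1
    simp only [Matrix.transpose_sub, Matrix.transpose_mul, Matrix.transpose_transpose,
      Matrix.sub_mul, Matrix.mul_sub, Matrix.mul_assoc, c]
    abel
  have nn : ∀ A : Matrix (Fin n) (Fin n) ℝ, 0 ≤ finner A A := by
    intro A
    unfold finner
    simp only [Matrix.trace, Matrix.diag, Matrix.mul_apply, Matrix.transpose_apply]
    exact Finset.sum_nonneg fun i _ => Finset.sum_nonneg fun j _ => mul_self_nonneg _
  have h := hX'.2 _ hX
  unfold fnorm at h ⊢
  rw [Real.sqrt_le_sqrt_iff (nn _), key, key] at h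
  exact Real.sqrt_le_sqrt (by linarith)
end
end
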